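/- arXiv:1412.7591 — 2 statements merged into one kernel-verified Lean document; each statement's English description precedes it below -/
import Mathlib

section
/- In the pre-Bloch group P(F) of an algebraically closed field F, for every z in F \ {0,1}, one has [z^{-1}] = -[z]. -/
/-- The set of "admissible" generators: elements of `F \ {0,1}`. -/
abbrev PBG (F : Type*) [Field F] : Type _ := {z : F // z ≠ 0 ∧ z ≠ 1}

/-- The subgroup of five-term relations in the free abelian group on `F \ {0,1}`. -/
def fiveTermRels (F : Type*) [Field F] : AddSubgroup (FreeAbelianGroup (PBG F)) :=
  AddSubgroup.closure
    { r | ∃ x y a b c : PBG F, x ≠ y ∧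
        (a : F) = (y : F) / (x : F) ∧
        (b : F) = (1 - (x : F)⁻¹) / (1 - (y : F)⁻¹) ∧
        (c : F) = (1 - (x : F)) / (1 - (y : F)) ∧
        r = FreeAbelianGroup.of x - FreeAbelianGroup.of y + FreeAbelianGroup.of a
            - FreeAbelianGroup.of b + FreeAbelianGroup.of c }

/-- The pre-Bloch group `P(F)`. -/
abbrev preBloch (F : Type*) [Field F] :=
  FreeAbelianGroup (PBG F) ⧸ fiveTermRels F

/-- The class `[z]` of a generator in the pre-Bloch group. -/
def pb {F : Type*} [Field F] (z : PBG F) : preBloch F :=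
  QuotientAddGroup.mk (FreeAbelianGroup.of z)

/-- The five-term relation in the pre-Bloch group. -/
theorem pb_five {F : Type*} [Field F] (x y a b c : PBG F) (hxy : x ≠ y)
    (ha : (a : F) = (y : F) / (x : F))
    (hb : (b : F) = (1 - (x : F)⁻¹) / (1 - (y : F)⁻¹))
    (hc : (c : F) = (1 - (x : F)) / (1 - (y : F))) :
    pb x - pb y + pb a - pb b + pb c = 0 := by
  have h : FreeAbelianGroup.of x - FreeAbelianGroup.of y + FreeAbelianGroup.of a
            - FreeAbelianGroup.of b + FreeAbelianGroup.of c ∈ fiveTermRels F :=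
    AddSubgroup.subset_closure ⟨x, y, a, b, c, hxy, ha, hb, hc, rfl⟩
  exact (QuotientAddGroup.eq_zero_iff _).2 h

/-- Inversion on `F \ {0,1}`. -/
def pbgInv {F : Type*} [Field F] (z : PBG F) : PBG F :=
  ⟨(z : F)⁻¹, inv_ne_zero z.2.1, fun h => z.2.2 (inv_eq_one.1 h)⟩

/-- The symbol `[z] + [z⁻¹]` is multiplicative. -/
theorem pb_sym_mul {F : Type*} [Field F] (a b c : PBG F) (hc : (c : F) = a * b) :
    pb c + pb (pbgInv c) = (pb a + pb (pbgInv a)) + (pb b + pb (pbgInv b)) := by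
  obtain ⟨a, ha0, ha1⟩ := a
  obtain ⟨b, hb0, hb1⟩ := b
  obtain ⟨c, hc0, hc1⟩ := c
  simp only at hc
  subst hc
  have hd : a * b - 1 ≠ 0 := sub_ne_zero.2 hc1
  have hd2 : b * a - 1 ≠ 0 := by rwa [mul_comm b a]
  have ha : a - 1 ≠ 0 := sub_ne_zero.2 ha1
  have hb : b - 1 ≠ 0 := sub_ne_zero.2 hb1
  have e1 : 1 - (a - 1) / (a * b - 1) = a * (b - 1) / (a * b - 1) := by
    field_simp; ring
  have e2 : 1 - b * (a - 1) / (a * b - 1) = (b - 1) / (a * b - 1) := by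
    field_simp; ring
  have hx0 : (a - 1) / (a * b - 1) ≠ 0 := div_ne_zero ha hd
  have hy0 : b * (a - 1) / (a * b - 1) ≠ 0 := div_ne_zero (mul_ne_zero hb0 ha) hd
  have hx1 : (a - 1) / (a * b - 1) ≠ 1 := fun h => by
    rw [h, sub_self] at e1
    exact div_ne_zero (mul_ne_zero ha0 hb) hd e1.symm
  have hy1 : b * (a - 1) / (a * b - 1) ≠ 1 := fun h => by
    rw [h, sub_self] at e2
    exact div_ne_zero hb hd e2.symm
  have e3 : 1 - ((a - 1) / (a * b - 1))⁻¹ = - (a * (b - 1) / (a - 1)) := by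
    field_simp; ring
  have e4 : 1 - (b * (a - 1) / (a * b - 1))⁻¹ = - ((b - 1) / (b * (a - 1))) := by
    field_simp; ring
  have hxy : (⟨_, hx0, hx1⟩ : PBG F) ≠ ⟨_, hy0, hy1⟩ := fun h => by
    have h' := congrArg (fun t : PBG F => (1 : F) - t) h
    simp only [e1, e2] at h'
    field_simp at h'
    exact ha1 h'
  have r1 := pb_five ⟨_, hx0, hx1⟩ ⟨_, hy0, hy1⟩ ⟨b, hb0, hb1⟩ ⟨a * b, hc0, hc1⟩ ⟨a, ha0, ha1⟩
    hxy (by simp only; field_simp) (by simp only [e3, e4]; field_simp)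
    (by simp only [e1, e2]; field_simp)
  have r2 := pb_five ⟨_, hy0, hy1⟩ ⟨_, hx0, hx1⟩ (pbgInv ⟨b, hb0, hb1⟩)
    (pbgInv ⟨a * b, hc0, hc1⟩) (pbgInv ⟨a, ha0, ha1⟩)
    hxy.symm (by simp only [pbgInv]; field_simp)
    (by simp only [pbgInv, e3, e4]; field_simp)
    (by simp only [pbgInv, e1, e2]; field_simp)
  rw [← sub_eq_zero, ← neg_eq_zero]
  rw [← add_zero (0 : preBloch F)]
  nth_rewrite 1 [← r1]
  rw [← r2]
  abel

/-- In the pre-Bloch group of an algebraically closed field, `[z⁻¹] = -[z]`. -/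
theorem preBloch_inv (F : Type*) [Field F] [IsAlgClosed F]
    (z w : PBG F) (hw : (w : F) = (z : F)⁻¹) :
    pb w = - pb z := by
  obtain ⟨s, hs⟩ := IsAlgClosed.exists_pow_nat_eq (z : F) (n := 2) (by norm_num)
  have hs0 : s ≠ 0 := by
    rintro rfl
    exact z.2.1 (by rw [← hs]; simp)
  have hs1 : s ≠ 1 := by
    rintro rfl
    exact z.2.2 (by rw [← hs]; simp)
  have hwz : w = pbgInv z := Subtype.ext hw
  have k1 := pb_sym_mul ⟨s, hs0, hs1⟩ ⟨s, hs0, hs1⟩ z (by rw [← hs, pow_two])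
  have k2 := pb_sym_mul z (pbgInv ⟨s, hs0, hs1⟩) ⟨s, hs0, hs1⟩
    (by simp only [pbgInv]; rw [← hs]; field_simp)
  have hii : pbgInv (pbgInv ⟨s, hs0, hs1⟩) = (⟨s, hs0, hs1⟩ : PBG F) :=
    Subtype.ext (inv_inv s)
  rw [hii, add_comm (pb (pbgInv _)) (pb _)] at k2
  rw [hwz, eq_neg_iff_add_eq_zero, add_comm]
  exact right_eq_add.1 k2
end

section
/- The map δ₀ on generators z ↦ z ∧ (1-z) from Z[F \ {0,1}] to the second exterior power of the multiplicative group F* kills every 5-term relation: for all distinct x, y in F \ {0,1}, one has x ∧ (1-x) - y ∧ (1-y) + (y/x) ∧ (1 - y/x) - ((1-x^{-1})/(1-y^{-1})) ∧ (1 - (1-x^{-1})/(1-y^{-1})) + ((1-x)/(1-y)) ∧ (1 - (1-x)/(1-y)) = 0 in ∧²F*. -/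
open TensorProduct

/-- The second exterior power `∧² F*`: the tensor square of the (additivized)
multiplicative group `Fˣ` over `ℤ`, modulo the subgroup generated by the
elements `x ⊗ y + y ⊗ x`. -/
abbrev Wedge2 (F : Type*) [Field F] :=
  (TensorProduct ℤ (Additive Fˣ) (Additive Fˣ)) ⧸
    AddSubgroup.closure
      { t : TensorProduct ℤ (Additive Fˣ) (Additive Fˣ) |
        ∃ x y : Fˣ, t = Additive.ofMul x ⊗ₜ[ℤ] Additive.ofMul y
          + Additive.ofMul y ⊗ₜ[ℤ] Additive.ofMul x }

/-- The wedge `x ∧ y` of two units. -/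
noncomputable def wedge {F : Type*} [Field F] (x y : Fˣ) : Wedge2 F :=
  QuotientAddGroup.mk (Additive.ofMul x ⊗ₜ[ℤ] Additive.ofMul y)

/-- The map `δ₀ : z ↦ z ∧ (1-z)` on elements of `F \ {0,1}`. -/
noncomputable def delta0 {F : Type*} [Field F] (z : F) (h0 : z ≠ 0) (h1 : z ≠ 1) : Wedge2 F :=
  wedge (Units.mk0 z h0) (Units.mk0 (1 - z) (sub_ne_zero.mpr (Ne.symm h1)))

theorem wedge_mul_left {F : Type*} [Field F] (a b c : Fˣ) :
    wedge (a * b) c = wedge a c + wedge b c := by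
  unfold wedge
  rw [ofMul_mul, TensorProduct.add_tmul]
  rfl

theorem wedge_mul_right {F : Type*} [Field F] (a b c : Fˣ) :
    wedge a (b * c) = wedge a b + wedge a c := by
  unfold wedge
  rw [ofMul_mul, TensorProduct.tmul_add]
  rfl

theorem wedge_div_left {F : Type*} [Field F] (a b c : Fˣ) :
    wedge (a / b) c = wedge a c - wedge b c := by
  rw [eq_sub_iff_add_eq, ← wedge_mul_left, div_mul_cancel]

theorem wedge_div_right {F : Type*} [Field F] (a b c : Fˣ) :
    wedge a (b / c) = wedge a b - wedge a c := by
  rw [eq_sub_iff_add_eq, ← wedge_mul_right, div_mul_cancel]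

theorem wedge_antisymm {F : Type*} [Field F] (a b : Fˣ) :
    wedge a b + wedge b a = 0 := by
  have h : (QuotientAddGroup.mk (Additive.ofMul a ⊗ₜ[ℤ] Additive.ofMul b
      + Additive.ofMul b ⊗ₜ[ℤ] Additive.ofMul a) : Wedge2 F) = 0 :=
    (QuotientAddGroup.eq_zero_iff _).2 (AddSubgroup.subset_closure ⟨a, b, rfl⟩)
  exact h

theorem delta0_eq {F : Type*} [Field F] (z : F) (h0 : z ≠ 0) (h1 : z ≠ 1) (u v : Fˣ)
    (hu : z = u) (hv : 1 - z = v) : delta0 z h0 h1 = wedge u v := by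
  unfold delta0
  congr 1
  · ext; exact hu
  · ext; exact hv

/-- `δ₀` kills every five-term relation. -/
theorem delta0_fiveTerm {F : Type*} [Field F] (x y : F) (hxy : x ≠ y)
    (hx0 : x ≠ 0) (hx1 : x ≠ 1) (hy0 : y ≠ 0) (hy1 : y ≠ 1)
    (ha0 : y / x ≠ 0) (ha1 : y / x ≠ 1)
    (hb0 : (1 - x⁻¹) / (1 - y⁻¹) ≠ 0) (hb1 : (1 - x⁻¹) / (1 - y⁻¹) ≠ 1)
    (hc0 : (1 - x) / (1 - y) ≠ 0) (hc1 : (1 - x) / (1 - y) ≠ 1) :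
    delta0 x hx0 hx1 - delta0 y hy0 hy1 + delta0 (y / x) ha0 ha1
      - delta0 ((1 - x⁻¹) / (1 - y⁻¹)) hb0 hb1
      + delta0 ((1 - x) / (1 - y)) hc0 hc1 = 0 := by
  have hA : 1 - x ≠ 0 := sub_ne_zero.mpr (Ne.symm hx1)
  have hB : 1 - y ≠ 0 := sub_ne_zero.mpr (Ne.symm hy1)
  have hB2 : y - 1 ≠ 0 := sub_ne_zero.mpr hy1
  have hD : x - y ≠ 0 := sub_ne_zero.mpr hxy
  have hb : (1 - x⁻¹) / (1 - y⁻¹) = ((1 - x) * y) / ((1 - y) * x) := by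
    have e1 : 1 - x⁻¹ = -(1 - x) / x := by field_simp; ring
    have e2 : 1 - y⁻¹ = -(1 - y) / y := by field_simp; ring
    rw [e1, e2]
    field_simp
  obtain ⟨X, hX⟩ : ∃ X : Fˣ, (X : F) = x := ⟨Units.mk0 x hx0, rfl⟩
  obtain ⟨Y, hY⟩ : ∃ X : Fˣ, (X : F) = y := ⟨Units.mk0 y hy0, rfl⟩
  obtain ⟨A, hA'⟩ : ∃ X : Fˣ, (X : F) = 1 - x := ⟨Units.mk0 _ hA, rfl⟩
  obtain ⟨B, hB'⟩ : ∃ X : Fˣ, (X : F) = 1 - y := ⟨Units.mk0 _ hB, rfl⟩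
  obtain ⟨D, hD'⟩ : ∃ X : Fˣ, (X : F) = x - y := ⟨Units.mk0 _ hD, rfl⟩
  rw [delta0_eq x hx0 hx1 X A hX.symm hA'.symm,
    delta0_eq y hy0 hy1 Y B hY.symm hB'.symm,
    delta0_eq (y / x) ha0 ha1 (Y / X) (D / X)
      (by rw [Units.val_div_eq_div_val, hX, hY])
      (by rw [Units.val_div_eq_div_val, hX, hD']; field_simp),
    delta0_eq _ hb0 hb1 ((A * Y) / (B * X)) (D / (B * X))
      (by rw [Units.val_div_eq_div_val, Units.val_mul, Units.val_mul, hX, hY, hA', hB', hb])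
      (by rw [Units.val_div_eq_div_val, Units.val_mul, hX, hB', hD', hb]; field_simp; ring),
    delta0_eq _ hc0 hc1 (A / B) (D / B)
      (by rw [Units.val_div_eq_div_val, hA', hB'])
      (by rw [Units.val_div_eq_div_val, hB', hD']; field_simp; ring)]
  simp only [wedge_div_left, wedge_div_right, wedge_mul_left, wedge_mul_right]
  have h1 := eq_neg_of_add_eq_zero_left (wedge_antisymm X A)
  have h2 := eq_neg_of_add_eq_zero_left (wedge_antisymm B X)
  rw [h1, h2]
  abel
end
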